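/- Let P ⊂ ℝ^d be a full-dimensional polytope with rational vertices and let H be a finite set of affine hyperplanes in ℝ^d each defined by a linear equation with rational coefficients. For positive integers t define I(t) := #{x ∈ (1/t)ℤ^d : x ∈ P° \ ⋃H} and O(t) := Σ_{x ∈ (1/t)ℤ^d ∩ P} mult(x), where mult(x) is the number of closed regions of (P,H) containing x. Then I and O agree with quasipolynomials for all positive integers t, i.e., there exist quasipolynomials f and g with f(t) = I(t) and g(t) = O(t) for all integers t ≥ 1, and these satisfy the reciprocity f(−t) = (−1)^d · g(t) for all integers t ≥ 1. -/

import Mathlib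

open scoped Classical

/-- A quasipolynomial: a function given on each residue class mod some period `N > 0` by a
polynomial. -/
def IsQuasiPoly (f : ℤ → ℚ) : Prop :=
  ∃ N : ℕ, 0 < N ∧ ∃ p : ℤ → Polynomial ℚ, ∀ t : ℤ, f t = (p (t % (N : ℤ))).eval (t : ℚ)

namespace EhrhartRec

open Polynomial

/-! ### Quasipolynomials -/

theorem qp_zero : IsQuasiPoly (fun _ => 0) :=
  ⟨1, one_pos, fun _ => 0, fun t => by simp⟩

theorem qp_add {f g : ℤ → ℚ} (hf : IsQuasiPoly f) (hg : IsQuasiPoly g) :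
    IsQuasiPoly (fun t => f t + g t) := by
  obtain ⟨N, hN, p, hp⟩ := hf
  obtain ⟨K, hK, q, hq⟩ := hg
  refine ⟨N * K, Nat.mul_pos hN hK, fun r => p (r % N) + q (r % K), fun t => ?_⟩
  beta_reduce
  rw [hp, hq]
  push_cast
  rw [Int.emod_emod_of_dvd t (dvd_mul_right _ _), Int.emod_emod_of_dvd t (dvd_mul_left _ _),
    eval_add]

theorem qp_sum {ι : Type*} (s : Finset ι) (f : ι → ℤ → ℚ) (hf : ∀ i ∈ s, IsQuasiPoly (f i)) :
    IsQuasiPoly (fun t => ∑ i ∈ s, f i t) := by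
  induction s using Finset.induction_on with
  | empty => simpa using qp_zero
  | insert a s ha ih =>
    simp only [Finset.sum_insert ha]
    exact qp_add (hf a (by simp)) (ih fun i hi => hf i (by simp [hi]))

theorem qp_reflect {f : ℤ → ℚ} (c : ℚ) (hf : IsQuasiPoly f) :
    IsQuasiPoly (fun t => c * f (-t)) := by
  obtain ⟨N, hN, p, hp⟩ := hf
  refine ⟨N, hN, fun r => C c * (p ((-r) % N)).comp (-X), fun t => ?_⟩
  have h : (-(t % (N : ℤ))) % (N : ℤ) = (-t) % (N : ℤ) :=
    (Int.ModEq.neg (Int.mod_modEq t N))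
  simp only [hp, h]
  simp

theorem exists_antidiff (p : ℚ[X]) : ∃ q : ℚ[X], ∀ s : ℚ, q.eval (s + 1) - q.eval s = p.eval s := by
  induction p using Polynomial.induction_on' with
  | add p q hp hq =>
    obtain ⟨a, ha⟩ := hp
    obtain ⟨b, hb⟩ := hq
    exact ⟨a + b, fun s => by simp only [eval_add]; rw [← ha, ← hb]; ring⟩
  | monomial n c =>
    refine ⟨C (c / (n + 1)) * Polynomial.bernoulli (n + 1), fun s => ?_⟩
    have h := Polynomial.bernoulli_eval_one_add (n + 1) s
    have hn : (n : ℚ) + 1 ≠ 0 := by positivity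
    simp only [eval_mul, eval_C, eval_monomial]
    rw [add_comm s 1, h]
    push_cast
    field_simp
    ring

theorem poly_of_diff (F : ℤ → ℚ) (p : ℚ[X]) (h : ∀ s : ℤ, F (s + 1) - F s = p.eval (s : ℚ)) :
    ∃ q : ℚ[X], ∀ s : ℤ, F s = q.eval (s : ℚ) := by
  obtain ⟨q, hq⟩ := exists_antidiff p
  refine ⟨q + C (F 0 - q.eval 0), fun s => ?_⟩
  have step : ∀ s : ℤ, F (s + 1) - q.eval ((s : ℚ) + 1) = F s - q.eval (s : ℚ) := fun s => by
    have h1 := h s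
    have h2 := hq s
    linarith
  have key : F s - q.eval (s : ℚ) = F 0 - q.eval 0 := by
    induction s using Int.induction_on with
    | zero => simp
    | succ n ih =>
      have := step n
      push_cast at *
      rw [this, ih]
    | pred n ih =>
      have := step (-n - 1)
      push_cast at *
      rw [← ih, ← this]
      simp
  simp only [eval_add, eval_C]
  linarith

theorem qp_of_diff (f : ℤ → ℚ) (h : ℤ) (hh : h ≠ 0)
    (hq : IsQuasiPoly (fun t => f (t + h) - f t)) : IsQuasiPoly f := by
  obtain ⟨N, hN, p, hp⟩ := hq
  have hNZ : (N : ℤ) ≠ 0 := by exact_mod_cast hN.ne'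
  have key : ∀ r : ℤ, ∃ q : ℚ[X], ∀ s : ℤ, f (r + N * h * s) = q.eval (s : ℚ) := fun r => by
    refine poly_of_diff (fun s => f (r + N * h * s))
      (∑ j ∈ Finset.range N, (p ((r + j * h) % N)).comp (C ((r : ℚ) + j * h) + C ((N : ℚ) * h) * X))
      fun s => ?_
    have tele : ∀ k : ℕ, f (r + N * h * s + k * h) - f (r + N * h * s) =
        ∑ j ∈ Finset.range k, (p ((r + j * h) % N)).eval ((r : ℚ) + N * h * s + j * h) := fun k => by
      induction k with
      | zero => simp
      | succ k ih =>
        rw [Finset.sum_range_succ, ← ih]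
        have h1 := hp (r + N * h * s + k * h)
        have h2 : (r + N * h * s + k * h) % (N : ℤ) = (r + k * h) % N := by
          rw [show r + N * h * s + k * h = (r + k * h) + N * (h * s) by ring, Int.add_mul_emod_self_left]
        rw [h2] at h1
        push_cast at h1 ⊢
        rw [← h1, show r + N * h * s + (k + 1) * h = r + N * h * s + k * h + h by ring]
        ring
    have := tele N
    rw [show r + N * h * s + N * h = r + N * h * (s + 1) by ring] at this
    rw [this, eval_finsetSum]
    refine Finset.sum_congr rfl fun j _ => ?_
    simp only [eval_comp, eval_add, eval_mul, eval_C, eval_X]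
    congr 1
    ring
  choose q hq using key
  refine ⟨N * h.natAbs, Nat.mul_pos hN (Int.natAbs_pos.2 hh),
    fun r => (q r).comp (C (1 / ((N : ℚ) * h)) * (X - C (r : ℚ))), fun t => ?_⟩
  have hd : (N : ℤ) * h ∣ t - t % ((N * h.natAbs : ℕ) : ℤ) := by
    have h1 : ((N * h.natAbs : ℕ) : ℤ) ∣ t - t % ((N * h.natAbs : ℕ) : ℤ) :=
      Int.dvd_self_sub_emod
    refine dvd_trans ?_ h1
    push_cast
    exact mul_dvd_mul_left _ ((dvd_abs h h).2 dvd_rfl)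
  obtain ⟨s, hs⟩ := hd
  set r := t % ((N * h.natAbs : ℕ) : ℤ) with hr
  have ht : t = r + N * h * s := by linarith
  have hsq : (s : ℚ) = 1 / ((N : ℚ) * h) * ((t : ℚ) - r) := by
    have h1 : (N : ℚ) ≠ 0 := by exact_mod_cast hN.ne'
    have h2 : (h : ℚ) ≠ 0 := by exact_mod_cast hh
    have : (t : ℚ) = r + N * h * s := by exact_mod_cast ht
    rw [this]
    field_simp
    ring
  simp only [eval_comp, eval_mul, eval_sub, eval_C, eval_X]
  rw [← hsq, ← hq, ← ht]

end EhrhartRec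
namespace EhrhartRec

/-! ### Difference operators on functions on the lattice -/

abbrev LatM (d : ℕ) := (Fin d → ℤ) × ℤ

abbrev CoV (d : ℕ) := (Fin d → ℚ) × ℚ

variable {d : ℕ}

/-- The difference operator in direction `v`. -/
def Dl (v : LatM d) : Module.End ℚ (LatM d → ℚ) where
  toFun G := fun z => G (z + v) - G z
  map_add' F G := by ext z; simp; ring
  map_smul' c G := by ext z; simp; ring

theorem Dl_apply (v : LatM d) (G : LatM d → ℚ) (z : LatM d) : Dl v G z = G (z + v) - G z := rfl

theorem Dl_comm (v w : LatM d) : Commute (Dl v) (Dl w) := by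
  refine LinearMap.ext fun G => ?_
  ext z
  simp only [Module.End.mul_apply, Dl_apply]
  rw [add_right_comm z v w]
  ring

/-- Composite of difference operators. -/
def DL (L : List (LatM d)) : Module.End ℚ (LatM d → ℚ) := (L.map Dl).prod

theorem DL_nil : DL ([] : List (LatM d)) = 1 := rfl

theorem DL_cons (v : LatM d) (L : List (LatM d)) : DL (v :: L) = Dl v * DL L := by
  simp [DL]

theorem DL_append (L K : List (LatM d)) : DL (L ++ K) = DL L * DL K := by
  simp [DL]

theorem Dl_DL_comm (v : LatM d) (L : List (LatM d)) : Commute (Dl v) (DL L) := by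
  induction L with
  | nil => exact Commute.one_right _
  | cons w L ih => rw [DL_cons]; exact (Dl_comm v w).mul_right ih

theorem DL_comm (K L : List (LatM d)) : Commute (DL K) (DL L) := by
  induction K with
  | nil => exact Commute.one_left _
  | cons w K ih => rw [DL_cons]; exact (Dl_DL_comm w L).mul_left ih

/-- Span of functions which are periodic in some nonzero direction. -/
def TorS (d : ℕ) : Submodule ℚ (LatM d → ℚ) :=
  Submodule.span ℚ {f | ∃ v : LatM d, v ≠ 0 ∧ ∀ z, f (z + v) = f z}

theorem tor_killed (f : LatM d → ℚ) (hf : f ∈ TorS d) :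
    ∃ L : List (LatM d), (∀ v ∈ L, v ≠ 0) ∧ DL L f = 0 := by
  induction hf using Submodule.span_induction with
  | mem f hf =>
    obtain ⟨v, hv, h⟩ := hf
    refine ⟨[v], by simpa using hv, ?_⟩
    ext z
    simp [DL_cons, DL_nil, Dl_apply, h]
  | zero => exact ⟨[], by simp, by simp⟩
  | add f g _ _ ihf ihg =>
    obtain ⟨L, hL, h1⟩ := ihf
    obtain ⟨K, hK, h2⟩ := ihg
    refine ⟨L ++ K, ?_, ?_⟩
    · intro v hv
      rcases List.mem_append.1 hv with h | h
      exacts [hL v h, hK v h]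
    · rw [map_add]
      have e1 : DL (L ++ K) f = 0 := by
        rw [DL_append, (DL_comm L K).eq, Module.End.mul_apply, h1, map_zero]
      have e2 : DL (L ++ K) g = 0 := by
        rw [DL_append, Module.End.mul_apply, h2, map_zero]
      rw [e1, e2, add_zero]
  | smul c f _ ih =>
    obtain ⟨L, hL, h1⟩ := ih
    exact ⟨L, hL, by rw [map_smul, h1, smul_zero]⟩

/-- Finite support on every slice. -/
def FinSl (G : LatM d → ℚ) : Prop := ∀ t : ℤ, {x : Fin d → ℤ | G (x, t) ≠ 0}.Finite

theorem finSl_Dl (v : LatM d) (G : LatM d → ℚ) (hG : FinSl G) : FinSl (Dl v G) := by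
  intro t
  have h1 : {x : Fin d → ℤ | G (x + v.1, t + v.2) ≠ 0}.Finite := by
    refine ((hG (t + v.2)).preimage (f := fun x => x + v.1) ?_)
    exact (add_left_injective v.1).injOn
  refine (h1.union (hG t)).subset fun x hx => ?_
  by_contra h
  simp only [Set.mem_union, Set.mem_ofPred_eq, not_or, not_not] at h
  apply hx
  rw [Dl_apply, Prod.add_def]
  simp [h.1, h.2]

theorem finSl_DL (L : List (LatM d)) (G : LatM d → ℚ) (hG : FinSl G) : FinSl (DL L G) := by
  induction L with
  | nil => simpa [DL_nil] using hG
  | cons w L ih => rw [DL_cons]; exact finSl_Dl _ _ ih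

theorem eq_zero_of_periodic (v : LatM d) (hv : v ≠ 0) (hv0 : v.2 = 0) (G : LatM d → ℚ)
    (hG : FinSl G) (h : Dl v G = 0) : G = 0 := by
  ext ⟨x, t⟩
  by_contra hx
  have hstep : ∀ z, G (z + v) = G z := fun z => by
    have := congrFun h z
    rw [Dl_apply] at this
    simpa [sub_eq_zero] using this
  have hk : ∀ k : ℕ, G (x + k • v.1, t) = G (x, t) := fun k => by
    induction k with
    | zero => simp
    | succ k ih =>
      rw [← ih, ← hstep (x + k • v.1, t), Prod.add_def]
      simp [hv0, add_assoc, add_mul]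
  have hv1 : v.1 ≠ 0 := fun h1 => hv (Prod.ext h1 hv0)
  have hinj : Function.Injective (fun k : ℕ => x + k • v.1) := by
    intro a b hab
    have := add_left_cancel hab
    obtain ⟨i, hi⟩ := Function.ne_iff.1 hv1
    have h2 := congrFun this i
    simp only [Pi.smul_apply, nsmul_eq_mul] at h2
    exact_mod_cast mul_right_cancel₀ hi h2
  refine Set.infinite_of_injective_forall_mem hinj (fun k => ?_) (hG t)
  rw [Set.mem_ofPred_eq, hk]
  exact hx

theorem drop_horizontal (L : List (LatM d)) (hL : ∀ v ∈ L, v ≠ 0) (G : LatM d → ℚ)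
    (hG : FinSl G) (h : DL L G = 0) :
    ∃ K : List (LatM d), (∀ v ∈ K, v.2 ≠ 0) ∧ DL K G = 0 := by
  induction L generalizing G with
  | nil => exact ⟨[], by simp, h⟩
  | cons v L ih =>
    rw [DL_cons, (Dl_DL_comm v L).eq, Module.End.mul_apply] at h
    obtain ⟨K, hK, h2⟩ := ih (fun w hw => hL w (by simp [hw])) (Dl v G) (finSl_Dl v G hG) h
    have h3 : Dl v (DL K G) = 0 := by
      rw [← Module.End.mul_apply, (Dl_DL_comm v K).eq, Module.End.mul_apply, h2]
    by_cases hv : v.2 = 0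
    · exact ⟨K, hK, eq_zero_of_periodic v (hL v (by simp)) hv _ (finSl_DL K G hG) h3⟩
    · refine ⟨v :: K, ?_, by rw [DL_cons]; exact h3⟩
      intro w hw
      rcases List.mem_cons.1 hw with rfl | hw
      exacts [hv, hK w hw]

/-- Slice sums. -/
noncomputable def psum (G : LatM d → ℚ) (t : ℤ) : ℚ := ∑ᶠ x : Fin d → ℤ, G (x, t)

theorem psum_Dl (v : LatM d) (G : LatM d → ℚ) (hG : FinSl G) (t : ℤ) :
    psum (Dl v G) t = psum G (t + v.2) - psum G t := by
  have h1 : {x : Fin d → ℤ | G (x + v.1, t + v.2) ≠ 0}.Finite := by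
    refine ((hG (t + v.2)).preimage (f := fun x => x + v.1) ?_)
    exact (add_left_injective v.1).injOn
  have e : psum G (t + v.2) = ∑ᶠ x : Fin d → ℤ, G (x + v.1, t + v.2) :=
    (finsum_comp_equiv (f := fun x => G (x, t + v.2)) (Equiv.addRight v.1)).symm
  rw [e, psum, psum, ← finsum_sub_distrib h1 (hG t)]
  rfl

theorem qp_of_DL (L : List (LatM d)) (hL : ∀ v ∈ L, v.2 ≠ 0) (G : LatM d → ℚ)
    (hG : FinSl G) (h : DL L G = 0) : IsQuasiPoly (psum G) := by
  induction L generalizing G with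
  | nil =>
    have : G = 0 := h
    subst this
    convert qp_zero using 1
    ext t
    simp [psum]
  | cons v L ih =>
    rw [DL_cons, (Dl_DL_comm v L).eq, Module.End.mul_apply] at h
    have := ih (fun w hw => hL w (by simp [hw])) (Dl v G) (finSl_Dl v G hG) h
    refine qp_of_diff _ v.2 (hL v (by simp)) ?_
    convert this using 2
    rw [psum_Dl v G hG]

theorem qp_of_tor (G : LatM d → ℚ) (hG : FinSl G) (h : G ∈ TorS d) : IsQuasiPoly (psum G) := by
  obtain ⟨L, hL, h1⟩ := tor_killed G h
  obtain ⟨K, hK, h2⟩ := drop_horizontal L hL G hG h1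
  exact qp_of_DL K hK G hG h2

end EhrhartRec
namespace EhrhartRec
variable {d : ℕ}

/-! ### Indicator functions of cones -/

/-- Evaluation of a rational linear functional at a lattice point. -/
def evZ (l : CoV d) (z : LatM d) : ℚ := ∑ i, l.1 i * (z.1 i : ℚ) + l.2 * (z.2 : ℚ)

/-- Evaluation of a rational linear functional at a real point. -/
noncomputable def evR (l : CoV d) (x : Fin d → ℝ) (t : ℝ) : ℝ :=
  ∑ i, (l.1 i : ℝ) * x i + (l.2 : ℝ) * t

theorem evZ_add (l : CoV d) (z w : LatM d) : evZ l (z + w) = evZ l z + evZ l w := by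
  simp only [evZ, Prod.fst_add, Prod.snd_add, Pi.add_apply, Int.cast_add, mul_add,
    Finset.sum_add_distrib]
  ring

theorem evZ_neg (l : CoV d) (z : LatM d) : evZ l (-z) = - evZ l z := by
  simp only [evZ, Prod.fst_neg, Prod.snd_neg, Pi.neg_apply, Int.cast_neg, mul_neg,
    Finset.sum_neg_distrib]
  ring

theorem evR_cast (l : CoV d) (z : LatM d) : ((evZ l z : ℚ) : ℝ) =
    evR l (fun i => (z.1 i : ℝ)) (z.2 : ℝ) := by
  simp [evZ, evR]

theorem evR_smul (l : CoV d) (c : ℝ) (x : Fin d → ℝ) (t : ℝ) :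
    evR l (c • x) (c * t) = c * evR l x t := by
  simp only [evR, Pi.smul_apply, smul_eq_mul, mul_add, Finset.mul_sum]
  congr 1
  · exact Finset.sum_congr rfl fun i _ => by ring
  · ring

theorem evR_add (l : CoV d) (x y : Fin d → ℝ) (t s : ℝ) :
    evR l (x + y) (t + s) = evR l x t + evR l y s := by
  simp only [evR, Pi.add_apply, mul_add, Finset.sum_add_distrib]
  ring

/-- The real functional as a linear map of the coefficient vector. -/
theorem evR_relation (I : Finset (CoV d)) (c : CoV d → ℚ) (h : ∑ l ∈ I, c l • l = 0)
    (x : Fin d → ℝ) (t : ℝ) : ∑ l ∈ I, (c l : ℝ) * evR l x t = 0 := by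
  have h1 : ∀ i, ∑ l ∈ I, c l * l.1 i = 0 := fun i => by
    have := congrFun (congrArg Prod.fst h) i
    simpa [Prod.fst_sum] using this
  have h2 : ∑ l ∈ I, c l * l.2 = 0 := by
    have := congrArg Prod.snd h
    simpa [Prod.snd_sum] using this
  simp only [evR, mul_add, Finset.sum_add_distrib, Finset.mul_sum]
  rw [Finset.sum_comm]
  have e1 : ∀ i, ∑ l ∈ I, (c l : ℝ) * ((l.1 i : ℝ) * x i) = 0 := fun i => by
    have : ∑ l ∈ I, (c l : ℝ) * (l.1 i : ℝ) = 0 := by exact_mod_cast h1 i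
    simp only [← mul_assoc]
    rw [← Finset.sum_mul, this, zero_mul]
  have e2 : ∑ l ∈ I, (c l : ℝ) * ((l.2 : ℝ) * t) = 0 := by
    have : ∑ l ∈ I, (c l : ℝ) * (l.2 : ℝ) = 0 := by exact_mod_cast h2
    simp only [← mul_assoc]
    rw [← Finset.sum_mul, this, zero_mul]
  simp [e1, e2]

theorem evZ_relation (I : Finset (CoV d)) (c : CoV d → ℚ) (h : ∑ l ∈ I, c l • l = 0)
    (z : LatM d) : ∑ l ∈ I, c l * evZ l z = 0 := by
  have := evR_relation I c h (fun i => (z.1 i : ℝ)) (z.2 : ℝ)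
  simp only [← evR_cast] at this
  exact_mod_cast this

/-- Indicator of the closed half space. -/
noncomputable def hsI (l : CoV d) (z : LatM d) : ℚ := if 0 ≤ evZ l z then 1 else 0

noncomputable def clI (I : Finset (CoV d)) (z : LatM d) : ℚ := ∏ l ∈ I, hsI l z

noncomputable def opI (I : Finset (CoV d)) (z : LatM d) : ℚ := ∏ l ∈ I, (1 - hsI l z)

theorem clI_eq (I : Finset (CoV d)) (z : LatM d) :
    clI I z = if ∀ l ∈ I, 0 ≤ evZ l z then 1 else 0 := by
  simp only [clI, hsI]
  exact Finset.prod_ite_zero.trans (by simp)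

theorem opI_eq (I : Finset (CoV d)) (z : LatM d) :
    opI I z = if ∀ l ∈ I, evZ l z < 0 then 1 else 0 := by
  have : ∀ l, 1 - hsI l z = if evZ l z < 0 then 1 else 0 := fun l => by
    unfold hsI
    split_ifs with h1 h2 h2
    · linarith
    · simp
    · simp
    · linarith
  simp only [opI, this]
  exact Finset.prod_ite_zero.trans (by simp)

theorem prod_one_sub' {ι : Type*} (P : Finset ι) (f : ι → ℚ) :
    ∏ i ∈ P, (1 - f i) = ∑ S ∈ P.powerset, (-1) ^ S.card * ∏ i ∈ S, f i := by
  have := Finset.prod_one_add (f := fun i => - f i) P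
  simp only [← sub_eq_add_neg] at this
  rw [this]
  exact Finset.sum_congr rfl fun S _ => Finset.prod_neg _

theorem exists_kernel (J : Finset (CoV d)) (hJ : J.card < d + 1) :
    ∃ v : LatM d, v ≠ 0 ∧ ∀ l ∈ J, evZ l v = 0 := by
  let φ : CoV d →ₗ[ℚ] (J → ℚ) :=
    { toFun := fun q l => ∑ i, l.1.1 i * q.1 i + l.1.2 * q.2
      map_add' := fun a b => by
        ext l
        simp only [Prod.fst_add, Prod.snd_add, Pi.add_apply, mul_add, Finset.sum_add_distrib]
        ring
      map_smul' := fun c a => by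
        ext l
        simp only [Prod.smul_fst, Prod.smul_snd, Pi.smul_apply, smul_eq_mul, RingHom.id_apply,
          mul_add, Finset.mul_sum]
        congr 1
        · exact Finset.sum_congr rfl fun i _ => by ring
        · ring }
  have hker : LinearMap.ker φ ≠ ⊥ := by
    apply LinearMap.ker_ne_bot_of_finrank_lt
    simpa using hJ
  obtain ⟨q, hq, hq0⟩ := (Submodule.ne_bot_iff _).1 hker
  let D : ℚ := (∏ i, ((q.1 i).den : ℚ)) * (q.2.den : ℚ)
  have hD : D ≠ 0 := by
    refine mul_ne_zero (Finset.prod_ne_zero_iff.2 fun i _ => ?_) ?_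
    · exact_mod_cast (q.1 i).den_ne_zero
    · exact_mod_cast q.2.den_ne_zero
  have hden : ∀ r : ℚ, (r.den : ℚ) * r = r.num := fun r => by
    rw [mul_comm]; exact Rat.mul_den_eq_num r
  have h1 : ∀ i, ∃ m : ℤ, (m : ℚ) = D * q.1 i := fun i => by
    refine ⟨(∏ j ∈ Finset.univ.erase i, ((q.1 j).den : ℤ)) * (q.2.den : ℤ) * (q.1 i).num, ?_⟩
    push_cast
    rw [← hden]
    simp only [D]
    rw [← Finset.mul_prod_erase Finset.univ _ (Finset.mem_univ i)]
    ring
  have h2 : ∃ m : ℤ, (m : ℚ) = D * q.2 := by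
    refine ⟨(∏ j, ((q.1 j).den : ℤ)) * q.2.num, ?_⟩
    push_cast
    rw [← hden]
    simp only [D]
    ring
  choose m hm using h1
  obtain ⟨n, hn⟩ := h2
  refine ⟨(m, n), ?_, ?_⟩
  · intro h0
    apply hq0
    have e1 : m = 0 := congrArg Prod.fst h0
    have e2 : n = 0 := congrArg Prod.snd h0
    refine Prod.ext (funext fun i => ?_) ?_
    · have := hm i
      rw [e1] at this
      simpa [hD] using this.symm
    · rw [e2] at hn
      simpa [hD] using hn.symm
  · intro l hl
    have h3 : φ q = 0 := hq
    have h4 : ∑ i, l.1 i * q.1 i + l.2 * q.2 = 0 := congrFun h3 ⟨l, hl⟩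
    simp only [evZ, hm, hn]
    have : ∑ i, l.1 i * (D * q.1 i) + l.2 * (D * q.2) =
        D * (∑ i, l.1 i * q.1 i + l.2 * q.2) := by
      rw [mul_add, Finset.mul_sum]
      congr 1
      · exact Finset.sum_congr rfl fun i _ => by ring
      · ring
    rw [this, h4, mul_zero]

theorem cl_mem_tor (J : Finset (CoV d)) (hJ : J.card < d + 1) : clI J ∈ TorS d := by
  obtain ⟨v, hv, h⟩ := exists_kernel J hJ
  refine Submodule.subset_span ⟨v, hv, fun z => ?_⟩
  refine Finset.prod_congr rfl fun l hl => ?_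
  simp only [hsI, evZ_add, h l hl, add_zero]

theorem op_mem_tor (J : Finset (CoV d)) (hJ : J.card < d + 1) : opI J ∈ TorS d := by
  obtain ⟨v, hv, h⟩ := exists_kernel J hJ
  refine Submodule.subset_span ⟨v, hv, fun z => ?_⟩
  refine Finset.prod_congr rfl fun l hl => ?_
  simp only [hsI, evZ_add, h l hl, add_zero]

noncomputable def Psi (I : Finset (CoV d)) : LatM d → ℚ := clI I - (-1 : ℚ) ^ (d + 1) • opI I

/-- Alternating sums over a circuit. -/
theorem circuit_sum (I P : Finset (CoV d)) (f : CoV d → ℚ) :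
    ∑ S ∈ P.powerset, (-1) ^ S.card * ∏ l ∈ (I \ P) ∪ S, f l =
      (∏ l ∈ I \ P, f l) * ∏ l ∈ P, (1 - f l) := by
  rw [prod_one_sub', Finset.mul_sum]
  refine Finset.sum_congr rfl fun S hS => ?_
  rw [Finset.prod_union]
  · ring
  · exact Finset.disjoint_of_subset_right (Finset.mem_powerset.1 hS) Finset.sdiff_disjoint

theorem psi_mem_tor (I : Finset (CoV d)) (x₀ : Fin d → ℝ) (t₀ : ℝ)
    (hpos : ∀ l ∈ I, 0 < evR l x₀ t₀) : Psi I ∈ TorS d := by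
  induction hn : I.card using Nat.strong_induction_on generalizing I with
  | _ n ih =>
  subst hn
  rcases lt_trichotomy I.card (d + 1) with hlt | heq | hgt
  · exact Submodule.sub_mem _ (cl_mem_tor I hlt) (Submodule.smul_mem _ _ (op_mem_tor I hlt))
  · have e : Psi I = -(-1 : ℚ) ^ (d + 1) • ∑ S ∈ I.powerset.erase I, (-1 : ℚ) ^ S.card • clI S := by
      ext z
      have h1 : opI I z = ∑ S ∈ I.powerset, (-1) ^ S.card * clI S z := prod_one_sub' I _
      rw [← Finset.add_sum_erase _ _ (Finset.mem_powerset_self I), heq] at h1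
      simp only [Psi, Pi.sub_apply, Pi.smul_apply, Finset.sum_apply, smul_eq_mul]
      rw [h1]
      have h2 : ((-1 : ℚ) ^ (d + 1)) * (-1) ^ (d + 1) = 1 := by
        rw [← mul_pow]; simp
      linear_combination (- clI I z) * h2
    rw [e]
    refine Submodule.smul_mem _ _ (Submodule.sum_mem _ fun S hS => Submodule.smul_mem _ _ ?_)
    apply cl_mem_tor
    rw [← heq]
    rw [Finset.mem_erase, Finset.mem_powerset] at hS
    exact Finset.card_lt_card (Finset.ssubset_iff_subset_ne.2 ⟨hS.2, hS.1⟩)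
  · obtain ⟨c, hc, hpc⟩ : ∃ c : CoV d → ℚ, ∑ l ∈ I, c l • l = 0 ∧ ∃ l ∈ I, 0 < c l := by
      have hfr : Module.finrank ℚ (CoV d) < I.card := by simpa using hgt
      obtain ⟨c, hc, l, hl, hcl⟩ := Module.exists_nontrivial_relation_of_finrank_lt_card hfr
      rcases lt_or_gt_of_ne hcl with h | h
      · exact ⟨fun l => - c l, by simp [hc], l, hl, by simpa using h⟩
      · exact ⟨c, hc, l, hl, h⟩
    obtain ⟨p, hp, hcp⟩ := hpc
    obtain ⟨q, hq, hcq⟩ : ∃ l ∈ I, c l < 0 := by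
      by_contra hcon
      push Not at hcon
      have h1 := evR_relation I c hc x₀ t₀
      have h2 : 0 < ∑ l ∈ I, (c l : ℝ) * evR l x₀ t₀ := by
        refine Finset.sum_pos' (fun l hl => mul_nonneg (by exact_mod_cast hcon l hl)
          (hpos l hl).le) ⟨p, hp, mul_pos (by exact_mod_cast hcp) (hpos p hp)⟩
      linarith
    set P := I.filter (fun l => 0 < c l) with hP
    have hPI : P ⊆ I := Finset.filter_subset _ _
    have hpP : p ∈ P := Finset.mem_filter.2 ⟨hp, hcp⟩
    have key1 : ∀ z, clI (I \ P) z * opI P z = 0 := fun z => by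
      rw [clI_eq, opI_eq, ite_zero_mul_ite_zero]
      rw [if_neg]
      rintro ⟨h1, h2⟩
      have h3 := evZ_relation I c hc z
      have h4 : 0 < ∑ l ∈ I, - (c l * evZ l z) := by
        refine Finset.sum_pos' (fun l hl => ?_) ⟨p, hp, ?_⟩
        · by_cases hlP : l ∈ P
          · have := h2 l hlP
            have := (Finset.mem_filter.1 hlP).2
            nlinarith
          · have := h1 l (Finset.mem_sdiff.2 ⟨hl, hlP⟩)
            have : c l ≤ 0 := by
              by_contra hh
              exact hlP (Finset.mem_filter.2 ⟨hl, not_le.1 hh⟩)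
            nlinarith
        · have := h2 p hpP
          nlinarith
      rw [Finset.sum_neg_distrib, h3] at h4
      simp at h4
    have key2 : ∀ z, opI (I \ P) z * clI P z = 0 := fun z => by
      rw [clI_eq, opI_eq, ite_zero_mul_ite_zero]
      rw [if_neg]
      rintro ⟨h1, h2⟩
      have h3 := evZ_relation I c hc z
      have h4 : 0 < ∑ l ∈ I, (c l * evZ l z) := by
        refine Finset.sum_pos' (fun l hl => ?_) ⟨q, hq, ?_⟩
        · by_cases hlP : l ∈ P
          · have := h2 l hlP
            have := (Finset.mem_filter.1 hlP).2
            positivity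
          · have := h1 l (Finset.mem_sdiff.2 ⟨hl, hlP⟩)
            have : c l ≤ 0 := by
              by_contra hh
              exact hlP (Finset.mem_filter.2 ⟨hl, not_le.1 hh⟩)
            nlinarith
        · have hqP : q ∉ P := fun hh => by
            have := (Finset.mem_filter.1 hh).2
            linarith
          have := h1 q (Finset.mem_sdiff.2 ⟨hq, hqP⟩)
          nlinarith
      linarith
    have hz : ∑ S ∈ P.powerset, (-1 : ℚ) ^ S.card • Psi ((I \ P) ∪ S) = 0 := by
      ext z
      have s1 : ∑ S ∈ P.powerset, (-1) ^ S.card * clI ((I \ P) ∪ S) z = 0 := by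
        have := circuit_sum I P (fun l => hsI l z)
        exact this.trans (key1 z)
      have s2 : ∑ S ∈ P.powerset, (-1) ^ S.card * opI ((I \ P) ∪ S) z = 0 := by
        have := circuit_sum I P (fun l => 1 - hsI l z)
        simp only [sub_sub_cancel] at this
        exact this.trans (key2 z)
      simp only [Finset.sum_apply, Pi.smul_apply, Psi, Pi.sub_apply, smul_eq_mul, mul_sub,
        Finset.sum_sub_distrib, s1, Pi.zero_apply, zero_sub, neg_eq_zero]
      simp only [mul_left_comm _ ((-1 : ℚ) ^ (d + 1)) _]
      rw [← Finset.mul_sum, s2, mul_zero]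
    rw [← Finset.add_sum_erase _ _ (Finset.mem_powerset_self P),
      Finset.sdiff_union_of_subset hPI] at hz
    have e : (-1 : ℚ) ^ P.card • Psi I ∈ TorS d := by
      rw [eq_neg_of_add_eq_zero_left hz]
      refine Submodule.neg_mem _ (Submodule.sum_mem _ fun S hS => Submodule.smul_mem _ _ ?_)
      rw [Finset.mem_erase, Finset.mem_powerset] at hS
      have hsub : (I \ P) ∪ S ⊂ I := by
        obtain ⟨a, haP, haS⟩ := Finset.exists_of_ssubset (Finset.ssubset_iff_subset_ne.2 ⟨hS.2, hS.1⟩)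
        refine (Finset.ssubset_iff_of_subset ?_).2 ⟨a, hPI haP, ?_⟩
        · exact Finset.union_subset Finset.sdiff_subset (hS.2.trans hPI)
        · simp [haP, haS]
      exact ih _ (Finset.card_lt_card hsub) _ (fun l hl => hpos l (hsub.subset hl)) rfl
    have := Submodule.smul_mem _ ((-1 : ℚ) ^ P.card) e
    rwa [smul_smul, ← mul_pow, neg_one_mul, neg_neg, one_pow, one_smul] at this

end EhrhartRec
namespace EhrhartRec
variable {d : ℕ}

/-! ### Ehrhart reciprocity for one region -/

def clR (I : Finset (CoV d)) : Set (Fin d → ℝ) := {x | ∀ l ∈ I, 0 ≤ evR l x 1}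

def opR (I : Finset (CoV d)) : Set (Fin d → ℝ) := {x | ∀ l ∈ I, 0 < evR l x 1}

theorem opR_subset_clR (I : Finset (CoV d)) : opR I ⊆ clR I := fun _ hx l hl => (hx l hl).le

theorem evR_div (l : CoV d) (x : Fin d → ℤ) (t : ℤ) (ht : 1 ≤ t) :
    ((evZ l (x, t) : ℚ) : ℝ) = (t : ℝ) * evR l (fun i => (x i : ℝ) / (t : ℝ)) 1 := by
  have ht' : (t : ℝ) ≠ 0 := by
    have : (0 : ℤ) < t := by omega
    exact_mod_cast this.ne'
  rw [evR_cast, ← evR_smul, mul_one]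
  congr 1
  ext i
  simp only [Pi.smul_apply, smul_eq_mul]
  field_simp

theorem mem_clR_iff (I : Finset (CoV d)) (x : Fin d → ℤ) (t : ℤ) (ht : 1 ≤ t) :
    (fun i => (x i : ℝ) / (t : ℝ)) ∈ clR I ↔ ∀ l ∈ I, 0 ≤ evZ l (x, t) := by
  have ht' : 0 < (t : ℝ) := by
    have : (0 : ℤ) < t := by omega
    exact_mod_cast this
  refine forall₂_congr fun l _ => ?_
  rw [← Rat.cast_nonneg (K := ℝ), evR_div l x t ht, mul_nonneg_iff_of_pos_left ht']

theorem mem_opR_iff (I : Finset (CoV d)) (x : Fin d → ℤ) (t : ℤ) (ht : 1 ≤ t) :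
    (fun i => (x i : ℝ) / (t : ℝ)) ∈ opR I ↔ ∀ l ∈ I, 0 < evZ l (x, t) := by
  have ht' : 0 < (t : ℝ) := by
    have : (0 : ℤ) < t := by omega
    exact_mod_cast this
  refine forall₂_congr fun l _ => ?_
  rw [← Rat.cast_pos (K := ℝ), evR_div l x t ht, mul_pos_iff_of_pos_left ht']

theorem finite_lattice (B : Set (Fin d → ℝ)) (R : ℝ) (hB : ∀ x ∈ B, ∀ i, |x i| ≤ R)
    (t : ℤ) (ht : 1 ≤ t) : {x : Fin d → ℤ | (fun i => (x i : ℝ) / (t : ℝ)) ∈ B}.Finite := by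
  have ht' : 0 < (t : ℝ) := by
    have : (0 : ℤ) < t := by omega
    exact_mod_cast this
  refine (Set.finite_Icc (fun _ : Fin d => -⌈R * t⌉) (fun _ => ⌈R * t⌉)).subset fun x hx => ?_
  have h : ∀ i, |(x i : ℝ)| ≤ ⌈R * t⌉ := fun i => by
    have h1 := hB _ hx i
    simp only [abs_div, abs_of_pos ht'] at h1
    rw [div_le_iff₀ ht'] at h1
    exact h1.trans (Int.le_ceil _)
  refine ⟨fun i => ?_, fun i => ?_⟩
  · have := (abs_le.1 (h i)).1
    exact_mod_cast this
  · have := (abs_le.1 (h i)).2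
    exact_mod_cast this

theorem evZ_height (z : LatM d) : evZ ((0, 1) : CoV d) z = z.2 := by simp [evZ]

theorem recession (I : Finset (CoV d)) (hne : (clR I).Nonempty) (R : ℝ)
    (hB : ∀ x ∈ clR I, ∀ i, |x i| ≤ R) (x : Fin d → ℝ) (hx : ∀ l ∈ I, 0 ≤ evR l x 0) : x = 0 := by
  obtain ⟨y, hy⟩ := hne
  ext i
  by_contra hi
  have hi' : 0 < |x i| := abs_pos.2 hi
  have hR : 0 ≤ R := (abs_nonneg _).trans (hB y hy i)
  set k : ℝ := (2 * R + 1) / |x i| with hk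
  have hk0 : 0 ≤ k := by positivity
  have hmem : y + k • x ∈ clR I := fun l hl => by
    have h1 := evR_add l y (k • x) 1 (k * 0)
    rw [evR_smul] at h1
    rw [mul_zero, add_zero] at h1
    rw [h1]
    have := hx l hl
    have := hy l hl
    positivity
  have h1 := hB _ hmem i
  have h2 := hB _ hy i
  have h3 : |k * x i| = 2 * R + 1 := by
    rw [abs_mul, abs_of_nonneg hk0, hk]
    field_simp
  simp only [Pi.add_apply, Pi.smul_apply, smul_eq_mul] at h1
  have h4 : |k * x i| ≤ |y i + k * x i| + |y i| := by
    have := abs_sub (y i + k * x i) (y i)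
    simpa using this
  linarith

theorem finSl_psi (I : Finset (CoV d)) (h01 : ((0, 1) : CoV d) ∈ I) (hne : (opR I).Nonempty)
    (R : ℝ) (hB : ∀ x ∈ clR I, ∀ i, |x i| ≤ R) : FinSl (Psi I) := by
  intro t
  have hsub : {x : Fin d → ℤ | Psi I (x, t) ≠ 0} ⊆
      {x | ∀ l ∈ I, 0 ≤ evZ l (x, t)} ∪ {x | ∀ l ∈ I, evZ l (x, t) < 0} := by
    intro x hx
    by_contra hcon
    simp only [Set.mem_union, Set.mem_ofPred_eq, not_or] at hcon
    apply hx
    simp only [Psi, Pi.sub_apply, Pi.smul_apply, clI_eq, opI_eq, if_neg hcon.1, if_neg hcon.2,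
      smul_zero, sub_zero]
  refine Set.Finite.subset (Set.Finite.union ?_ ?_) hsub
  · rcases lt_trichotomy t 0 with h | h | h
    · convert Set.finite_empty
      ext x
      simp only [Set.mem_ofPred_eq, Set.mem_empty_iff_false, iff_false]
      intro hx
      have := hx _ h01
      rw [evZ_height] at this
      have : (0 : ℤ) ≤ t := by exact_mod_cast this
      omega
    · refine (Set.finite_singleton 0).subset fun x hx => ?_
      have := recession I (hne.mono (opR_subset_clR I)) R hB (fun i => (x i : ℝ)) fun l hl => by
        have h1 := hx l hl
        rw [← Rat.cast_nonneg (K := ℝ), evR_cast, h] at h1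
        simpa using h1
      rw [Set.mem_singleton_iff]
      ext i
      have := congrFun this i
      simpa using this
    · have ht : 1 ≤ t := by omega
      refine (finite_lattice (clR I) R hB t ht).subset fun x hx => ?_
      exact (mem_clR_iff I x t ht).2 hx
  · rcases lt_or_ge t 0 with h | h
    · have ht : 1 ≤ -t := by omega
      refine ((finite_lattice (clR I) R hB (-t) ht).preimage (f := fun x => -x)
        neg_injective.injOn).subset fun x hx => ?_
      refine (mem_clR_iff I (-x) (-t) ht).2 fun l hl => ?_
      have h1 := evZ_neg l (x, t)
      rw [Prod.neg_mk] at h1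
      rw [h1]
      have := hx l hl
      linarith
    · convert Set.finite_empty
      ext x
      simp only [Set.mem_ofPred_eq, Set.mem_empty_iff_false, iff_false]
      intro hx
      have := hx _ h01
      rw [evZ_height] at this
      have : t < (0 : ℤ) := by exact_mod_cast this
      omega

theorem ehrhart (I : Finset (CoV d)) (h01 : ((0, 1) : CoV d) ∈ I) (hne : (opR I).Nonempty)
    (R : ℝ) (hB : ∀ x ∈ clR I, ∀ i, |x i| ≤ R) :
    ∃ g : ℤ → ℚ, IsQuasiPoly g ∧
      (∀ t : ℤ, 1 ≤ t → g t =
        ∑ᶠ x : Fin d → ℤ, if (fun i => (x i : ℝ) / (t : ℝ)) ∈ clR I then (1 : ℚ) else 0) ∧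
      (∀ t : ℤ, 1 ≤ t → g (-t) = (-1) ^ d *
        ∑ᶠ x : Fin d → ℤ, if (fun i => (x i : ℝ) / (t : ℝ)) ∈ opR I then (1 : ℚ) else 0) := by
  obtain ⟨x₀, hx₀⟩ := hne
  refine ⟨psum (Psi I), qp_of_tor _ (finSl_psi I h01 ⟨x₀, hx₀⟩ R hB) (psi_mem_tor I x₀ 1 hx₀),
    fun t ht => ?_, fun t ht => ?_⟩
  · refine finsum_congr fun x => ?_
    have h1 : ¬ ∀ l ∈ I, evZ l (x, t) < 0 := fun h => by
      have := h _ h01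
      rw [evZ_height] at this
      have : t < (0 : ℤ) := by exact_mod_cast this
      omega
    simp only [Psi, Pi.sub_apply, Pi.smul_apply, clI_eq, opI_eq, mem_clR_iff I x t ht, if_neg h1,
      smul_zero, sub_zero]
  · have e : psum (Psi I) (-t) = ∑ᶠ x : Fin d → ℤ, Psi I (-x, -t) :=
      (finsum_comp_equiv (f := fun x => Psi I (x, -t)) (Equiv.neg (Fin d → ℤ))).symm
    rw [e, mul_finsum]
    refine finsum_congr fun x => ?_
    have h1 : ¬ ∀ l ∈ I, 0 ≤ evZ l (-x, -t) := fun h => by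
      have := h _ h01
      rw [evZ_height] at this
      have : (0 : ℤ) ≤ -t := by exact_mod_cast this
      omega
    have h2 : (∀ l ∈ I, evZ l (-x, -t) < 0) ↔ ∀ l ∈ I, 0 < evZ l (x, t) := by
      refine forall₂_congr fun l _ => ?_
      have := evZ_neg l (x, t)
      rw [Prod.neg_mk] at this
      rw [this, neg_lt_zero]
    simp only [Psi, Pi.sub_apply, Pi.smul_apply, clI_eq, opI_eq, mem_opR_iff I x t ht, if_neg h1,
      h2, smul_eq_mul, pow_succ]
    ring

end EhrhartRec
namespace EhrhartRec
variable {d : ℕ}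

/-! ### Rational half space description of a rational polytope -/

/-- Pairing of rational functionals and rational points. -/
def pairQ (l w : CoV d) : ℚ := ∑ i, l.1 i * w.1 i + l.2 * w.2

theorem evR_comb (l m : CoV d) (a b : ℚ) (x : Fin d → ℝ) (t : ℝ) :
    evR (a • l + b • m) x t = a * evR l x t + b * evR m x t := by
  simp only [evR, Prod.fst_add, Prod.snd_add, Prod.smul_fst, Prod.smul_snd, Pi.add_apply,
    Pi.smul_apply, smul_eq_mul, mul_add, Finset.mul_sum]
  push_cast
  simp only [add_mul, Finset.sum_add_distrib, mul_assoc]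
  ring

theorem evR_neg_left (l : CoV d) (x : Fin d → ℝ) (t : ℝ) : evR (-l) x t = - evR l x t := by
  have := evR_comb l 0 (-1) 0 x t
  simpa using this

theorem fourier_motzkin (I : Finset (CoV d)) (w : CoV d) :
    ∃ I' : Finset (CoV d), ∀ (x : Fin d → ℝ) (t : ℝ), (∀ l ∈ I', 0 ≤ evR l x t) ↔
      ∃ c : ℝ, 0 ≤ c ∧ ∀ l ∈ I, 0 ≤ evR l x t - c * (pairQ l w : ℝ) := by
  let Pos := I.filter (fun l => 0 < pairQ l w)
  let Neg := I.filter (fun l => pairQ l w < 0)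
  refine ⟨I.filter (fun l => 0 ≤ pairQ l w) ∪
    (Pos ×ˢ Neg).image (fun pn => pairQ pn.1 w • pn.2 + (-pairQ pn.2 w) • pn.1), fun x t => ?_⟩
  constructor
  · intro h
    have h1 : ∀ l ∈ I, 0 ≤ pairQ l w → 0 ≤ evR l x t := fun l hl hp =>
      h l (Finset.mem_union_left _ (Finset.mem_filter.2 ⟨hl, hp⟩))
    have h2 : ∀ p ∈ I, ∀ n ∈ I, 0 < pairQ p w → pairQ n w < 0 →
        0 ≤ (pairQ p w : ℝ) * evR n x t - (pairQ n w : ℝ) * evR p x t := fun p hp n hn hp0 hn0 => by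
      have := h _ (Finset.mem_union_right _ (Finset.mem_image_of_mem _
        (Finset.mem_product.2 ⟨Finset.mem_filter.2 ⟨hp, hp0⟩, Finset.mem_filter.2 ⟨hn, hn0⟩⟩ :
          (p, n) ∈ Pos ×ˢ Neg)))
      rw [evR_comb] at this
      push_cast at this
      linarith
    obtain ⟨c, hc0, hcN, hcP⟩ : ∃ c : ℝ, 0 ≤ c ∧
        (∀ n ∈ I, pairQ n w < 0 → evR n x t / (pairQ n w : ℝ) ≤ c) ∧
        (∀ p ∈ I, 0 < pairQ p w → c ≤ evR p x t / (pairQ p w : ℝ)) := by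
      let T : Finset ℝ := insert 0 (Neg.image (fun n => evR n x t / (pairQ n w : ℝ)))
      have hT : T.Nonempty := Finset.insert_nonempty _ _
      refine ⟨T.max' hT, Finset.le_max' _ _ (Finset.mem_insert_self _ _), fun n hn hn0 => ?_,
        fun p hp hp0 => ?_⟩
      · have hnN : n ∈ Neg := Finset.mem_filter.2 ⟨hn, hn0⟩
        exact Finset.le_max' _ _ (Finset.mem_insert_of_mem (Finset.mem_image_of_mem
          (fun n => evR n x t / (pairQ n w : ℝ)) hnN))
      · have hp0' : (0 : ℝ) < pairQ p w := by exact_mod_cast hp0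
        refine Finset.max'_le _ _ _ fun y hy => ?_
        rcases Finset.mem_insert.1 hy with rfl | hy
        · exact div_nonneg (h1 p hp hp0.le) hp0'.le
        · obtain ⟨n, hn, rfl⟩ := Finset.mem_image.1 hy
          obtain ⟨hn, hn0⟩ := Finset.mem_filter.1 hn
          have hn0' : (pairQ n w : ℝ) < 0 := by exact_mod_cast hn0
          have := h2 p hp n hn hp0 hn0
          rw [div_le_iff_of_neg hn0', div_mul_eq_mul_div, div_le_iff₀ hp0']
          linarith
    refine ⟨c, hc0, fun l hl => ?_⟩
    rcases lt_trichotomy (pairQ l w) 0 with h0 | h0 | h0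
    · have h0' : (pairQ l w : ℝ) < 0 := by exact_mod_cast h0
      have := hcN l hl h0
      rw [div_le_iff_of_neg h0'] at this
      linarith
    · rw [h0]
      simpa using h1 l hl h0.ge
    · have h0' : (0 : ℝ) < pairQ l w := by exact_mod_cast h0
      have := hcP l hl h0
      rw [le_div_iff₀ h0'] at this
      linarith
  · rintro ⟨c, hc, h⟩ l hl
    rcases Finset.mem_union.1 hl with hl | hl
    · obtain ⟨hl, h0⟩ := Finset.mem_filter.1 hl
      have h0' : (0 : ℝ) ≤ pairQ l w := by exact_mod_cast h0
      have := h l hl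
      have := mul_nonneg hc h0'
      linarith
    · obtain ⟨⟨p, n⟩, hpn, rfl⟩ := Finset.mem_image.1 hl
      obtain ⟨hp, hn⟩ := Finset.mem_product.1 hpn
      obtain ⟨hp, hp0⟩ := Finset.mem_filter.1 hp
      obtain ⟨hn, hn0⟩ := Finset.mem_filter.1 hn
      have hp0' : (0 : ℝ) < pairQ p w := by exact_mod_cast hp0
      have hn0' : (pairQ n w : ℝ) < 0 := by exact_mod_cast hn0
      have e1 := mul_nonneg hp0'.le (h n hn)
      have e2 := mul_nonneg (neg_nonneg.2 hn0'.le) (h p hp)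
      simp only at hp0' hn0' e1 e2 ⊢
      rw [evR_comb]
      push_cast
      nlinarith

theorem cone_description (Vs : Finset (Fin d → ℚ)) :
    ∃ I : Finset (CoV d), ∀ (x : Fin d → ℝ) (t : ℝ), (∀ l ∈ I, 0 ≤ evR l x t) ↔
      ∃ c : (Fin d → ℚ) → ℝ, (∀ v ∈ Vs, 0 ≤ c v) ∧ (∀ i, ∑ v ∈ Vs, c v * (v i : ℝ) = x i) ∧
        ∑ v ∈ Vs, c v = t := by
  induction Vs using Finset.induction_on with
  | empty =>
    refine ⟨Finset.univ.image (fun i => ((Pi.single i 1, 0) : CoV d)) ∪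
      Finset.univ.image (fun i => -((Pi.single i 1, 0) : CoV d)) ∪ {(0, 1), -(0, 1)}, fun x t => ?_⟩
    have e1 : ∀ i, evR ((Pi.single i 1, 0) : CoV d) x t = x i := fun i => by
      simp only [evR, Pi.single_apply, apply_ite (Rat.cast : ℚ → ℝ)]
      simp
    have e2 : evR ((0, 1) : CoV d) x t = t := by simp [evR]
    constructor
    · intro h
      refine ⟨0, by simp, fun i => ?_, ?_⟩
      · have h1 := h (Pi.single i 1, 0) (by simp)
        have h2 := h (-(Pi.single i 1, 0)) (Finset.mem_union_left _ (Finset.mem_union_right _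
          (Finset.mem_image_of_mem _ (Finset.mem_univ i))))
        rw [evR_neg_left, e1] at h2
        rw [e1] at h1
        rw [Finset.sum_empty]
        linarith
      · have h1 := h (0, 1) (by simp)
        have h2 := h (-(0, 1)) (by simp)
        rw [evR_neg_left, e2] at h2
        rw [e2] at h1
        rw [Finset.sum_empty]
        linarith
    · rintro ⟨c, -, h1, h2⟩ l -
      have hx : x = 0 := funext fun i => by simpa using (h1 i).symm
      have ht : t = 0 := by simpa using h2.symm
      simp [evR, hx, ht]
  | insert v Vs hv ih =>
    obtain ⟨I, hI⟩ := ih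
    obtain ⟨I', hI'⟩ := fourier_motzkin I (v, 1)
    refine ⟨I', fun x t => (hI' x t).trans ?_⟩
    have key : ∀ c : ℝ, (∀ l ∈ I, 0 ≤ evR l x t - c * (pairQ l (v, 1) : ℝ)) ↔
        ∀ l ∈ I, 0 ≤ evR l (fun i => x i - c * (v i : ℝ)) (t - c) := fun c => by
      refine forall₂_congr fun l _ => ?_
      have : evR l (fun i => x i - c * (v i : ℝ)) (t - c) =
          evR l x t - c * (pairQ l (v, 1) : ℝ) := by
        simp only [evR, pairQ]
        push_cast
        simp only [mul_sub, mul_add, Finset.sum_sub_distrib, Finset.mul_sum]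
        have : ∀ i, (l.1 i : ℝ) * (c * (v i : ℝ)) = c * ((l.1 i : ℝ) * (v i : ℝ)) := fun i => by ring
        simp only [this]
        ring
      rw [this]
    simp only [key, hI]
    constructor
    · rintro ⟨c, hc, c', h0, h1, h2⟩
      have hne : ∀ u ∈ Vs, (Function.update c' v c) u = c' u := fun u hu =>
        Function.update_of_ne (by rintro rfl; exact hv hu) _ _
      refine ⟨Function.update c' v c, fun u hu => ?_, fun i => ?_, ?_⟩
      · rcases Finset.mem_insert.1 hu with rfl | hu
        · simpa using hc
        · rw [hne u hu]; exact h0 u hu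
      · rw [Finset.sum_insert hv, Finset.sum_congr rfl fun u hu => by rw [hne u hu], h1]
        simp
      · rw [Finset.sum_insert hv, Finset.sum_congr rfl hne, h2]
        simp
    · rintro ⟨c, h0, h1, h2⟩
      refine ⟨c v, h0 v (by simp), c, fun u hu => h0 u (by simp [hu]), fun i => ?_, ?_⟩
      · rw [← h1, Finset.sum_insert hv]; ring
      · rw [← h2, Finset.sum_insert hv]; ring

theorem hull_description (Vs : Finset (Fin d → ℚ)) : ∃ I : Finset (CoV d),
    convexHull ℝ ((fun v : Fin d → ℚ => fun i => (v i : ℝ)) '' (Vs : Set (Fin d → ℚ))) = clR I := by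
  obtain ⟨I, hI⟩ := cone_description Vs
  refine ⟨I, ?_⟩
  have hinj : Function.Injective (fun v : Fin d → ℚ => fun i => (v i : ℝ)) := fun v w h =>
    funext fun i => by
      have := congrFun h i
      simpa using this
  ext x
  rw [← Finset.coe_image, Finset.mem_convexHull']
  refine Iff.trans ?_ (hI x 1).symm
  constructor
  · rintro ⟨w, h0, h1, h2⟩
    rw [Finset.sum_image hinj.injOn] at h1 h2
    refine ⟨fun v => w (fun i => (v i : ℝ)), fun v hv => h0 _ (Finset.mem_image_of_mem _ hv),
      fun i => ?_, h1⟩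
    rw [← h2]
    simp
  · rintro ⟨c, h0, h1, h2⟩
    have hli : ∀ v, c (Function.invFun (fun v : Fin d → ℚ => fun i => (v i : ℝ))
        (fun i => (v i : ℝ))) = c v := fun v => by
      rw [Function.leftInverse_invFun hinj v]
    refine ⟨fun y => c (Function.invFun (fun v : Fin d → ℚ => fun i => (v i : ℝ)) y), ?_, ?_, ?_⟩
    · intro y hy
      obtain ⟨v, hv, rfl⟩ := Finset.mem_image.1 hy
      simp only [hli]
      exact h0 v hv
    · rw [Finset.sum_image hinj.injOn]
      simp only [hli]
      exact h2
    · rw [Finset.sum_image hinj.injOn]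
      simp only [hli]
      ext i
      rw [← h1 i]
      simp

/-! ### Topology of regions -/

theorem continuous_evR (l : CoV d) : Continuous (fun x : Fin d → ℝ => evR l x 1) := by
  unfold evR
  fun_prop

theorem isOpen_opR (I : Finset (CoV d)) : IsOpen (opR I) := by
  have : opR I = ⋂ l ∈ I, {x | 0 < evR l x 1} := by ext x; simp [opR]
  rw [this]
  exact isOpen_biInter_finset fun l _ => isOpen_lt continuous_const (continuous_evR l)

theorem isClosed_clR (I : Finset (CoV d)) : IsClosed (clR I) := by
  have : clR I = ⋂ l ∈ I, {x | 0 ≤ evR l x 1} := by ext x; simp [clR]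
  rw [this]
  exact isClosed_biInter fun l _ => isClosed_le continuous_const (continuous_evR l)

theorem evR_convex (l : CoV d) (x y : Fin d → ℝ) (a b : ℝ) (hab : a + b = 1) :
    evR l (a • x + b • y) 1 = a * evR l x 1 + b * evR l y 1 := by
  rw [← evR_smul, ← evR_smul, ← evR_add, mul_one, mul_one, hab]

theorem mix_mem_opR (I : Finset (CoV d)) {x y : Fin d → ℝ} (hx : x ∈ opR I) (hy : y ∈ clR I)
    {a b : ℝ} (ha : 0 < a) (hb : 0 ≤ b) (hab : a + b = 1) : a • x + b • y ∈ opR I := fun l hl => by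
  rw [evR_convex l x y a b hab]
  have := hx l hl
  have := hy l hl
  positivity

theorem convex_opR (I : Finset (CoV d)) : Convex ℝ (opR I) := by
  intro x hx y hy a b ha hb hab
  rcases ha.eq_or_lt with rfl | ha
  · have : b = 1 := by linarith
    subst this
    simpa using hy
  · exact mix_mem_opR I hx (opR_subset_clR I hy) ha hb hab

theorem closure_opR (I : Finset (CoV d)) (hne : (opR I).Nonempty) : closure (opR I) = clR I := by
  apply Set.Subset.antisymm
  · exact closure_minimal (opR_subset_clR I) (isClosed_clR I)
  · obtain ⟨x, hx⟩ := hne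
    intro y hy
    have hc : Continuous (fun a : ℝ => a • x + (1 - a) • y) := by fun_prop
    have ht : Filter.Tendsto (fun a : ℝ => a • x + (1 - a) • y) (nhdsWithin 0 (Set.Ioi 0))
        (nhds y) := by
      have := (hc.tendsto 0).mono_left (nhdsWithin_le_nhds (s := Set.Ioi 0))
      simpa using this
    refine mem_closure_of_tendsto ht ?_
    filter_upwards [Ioo_mem_nhdsGT (zero_lt_one' ℝ)] with a ha
    exact mix_mem_opR I hx hy ha.1 (by linarith [ha.2]) (by ring)

theorem interior_clR (I : Finset (CoV d)) (h0 : (0 : CoV d) ∉ I) :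
    interior (clR I) = opR I := by
  apply Set.Subset.antisymm
  · intro x hx l hl
    have hxl := interior_subset hx l hl
    rcases hxl.lt_or_eq with h | h
    · exact h
    exfalso
    by_cases hl1 : l.1 = 0
    · have h2 : (l.2 : ℝ) = 0 := by simpa [evR, hl1] using h.symm
      have h2' : l.2 = 0 := by exact_mod_cast h2
      exact h0 ((Prod.ext hl1 h2' : l = 0) ▸ hl)
    · let u : Fin d → ℝ := fun i => (l.1 i : ℝ)
      have hu : evR l u 0 > 0 := by
        obtain ⟨i, hi⟩ := Function.ne_iff.1 hl1
        have hi' : (l.1 i : ℝ) ≠ 0 := by exact_mod_cast hi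
        simp only [evR, mul_zero, add_zero, u]
        exact Finset.sum_pos' (fun j _ => mul_self_nonneg _) ⟨i, Finset.mem_univ i, mul_self_pos.2 hi'⟩
      have hc : Continuous (fun a : ℝ => x + (-a) • u) := by fun_prop
      have ht : Filter.Tendsto (fun a : ℝ => x + (-a) • u) (nhdsWithin 0 (Set.Ioi 0))
          (nhds x) := by
        have := (hc.tendsto 0).mono_left (nhdsWithin_le_nhds (s := Set.Ioi 0))
        simpa using this
      have hev := ht.eventually (mem_interior_iff_mem_nhds.1 hx)
      obtain ⟨a, ha, ha0⟩ := (hev.and self_mem_nhdsWithin).exists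
      have h1 := ha l hl
      have h2 := evR_add l x ((-a) • u) 1 ((-a) * 0)
      rw [evR_smul, mul_zero, add_zero] at h2
      rw [h2, ← h] at h1
      have : 0 < a := ha0
      nlinarith
  · exact interior_maximal (opR_subset_clR I) (isOpen_opR I)

theorem polytope_description (P : Set (Fin d → ℝ))
    (hP : ∃ Vs : Finset (Fin d → ℚ),
      P = convexHull ℝ ((fun v : Fin d → ℚ => fun i => (v i : ℝ)) '' (Vs : Set (Fin d → ℚ)))) :
    ∃ I : Finset (CoV d), ((0, 1) : CoV d) ∈ I ∧ P = clR I ∧ interior P = opR I ∧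
      ∃ R : ℝ, ∀ x ∈ P, ∀ i, |x i| ≤ R := by
  obtain ⟨Vs, hVs⟩ := hP
  obtain ⟨I, hI⟩ := hull_description Vs
  have hPI : P = clR (insert (0, 1) (I.filter (fun l => l ≠ 0))) := by
    rw [hVs, hI]
    ext x
    constructor
    · intro hx l hl
      rcases Finset.mem_insert.1 hl with rfl | hl
      · simp [evR]
      · exact hx l (Finset.mem_filter.1 hl).1
    · intro hx l hl
      by_cases h : l = 0
      · simp [h, evR]
      · exact hx l (Finset.mem_insert_of_mem (Finset.mem_filter.2 ⟨hl, h⟩))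
  refine ⟨insert (0, 1) (I.filter (fun l => l ≠ 0)), Finset.mem_insert_self _ _, hPI, ?_, ?_⟩
  · rw [hPI]
    refine interior_clR _ ?_
    simp [Prod.ext_iff]
  · have hb : Bornology.IsBounded P := by
      rw [hVs]
      exact (isBounded_convexHull).2 ((Vs.finite_toSet.image _).isBounded)
    obtain ⟨R, hR⟩ := hb.exists_norm_le
    exact ⟨R, fun x hx i => (norm_le_pi_norm x i).trans (hR x hx)⟩

end EhrhartRec
namespace EhrhartRec
variable {d : ℕ}

/-! ### Regions of the arrangement -/

theorem finsum_ind {α : Type*} (s : Set α) (hs : s.Finite) :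
    ∑ᶠ x, (if x ∈ s then (1 : ℚ) else 0) = Nat.card s := by
  rw [finsum_eq_sum_of_support_subset (s := hs.toFinset)]
  · rw [Finset.sum_congr rfl fun x hx => if_pos ((Set.Finite.mem_toFinset hs).1 hx)]
    rw [Nat.card_coe_set_eq, Set.ncard_eq_toFinset_card s hs]
    simp
  · intro x hx
    by_contra h
    apply hx
    exact if_neg (by simpa using h)

/-- The inequalities of the region with sign pattern `S`. -/
noncomputable def regI (I : Finset (CoV d)) (H : Finset (Set (Fin d → ℝ)))
    (lf : Set (Fin d → ℝ) → CoV d) (S : Finset (Set (Fin d → ℝ))) : Finset (CoV d) :=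
  I ∪ (S.image lf ∪ (H \ S).image (fun A => - lf A))

theorem mem_opR_regI (I : Finset (CoV d)) (H : Finset (Set (Fin d → ℝ)))
    (lf : Set (Fin d → ℝ) → CoV d) (S : Finset (Set (Fin d → ℝ))) (x : Fin d → ℝ) :
    x ∈ opR (regI I H lf S) ↔ x ∈ opR I ∧ (∀ A ∈ S, 0 < evR (lf A) x 1) ∧
      ∀ A ∈ H, A ∉ S → evR (lf A) x 1 < 0 := by
  constructor
  · intro h
    refine ⟨fun l hl => h l (Finset.mem_union_left _ hl), fun A hA => ?_, fun A hA hAS => ?_⟩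
    · exact h _ (Finset.mem_union_right _ (Finset.mem_union_left _ (Finset.mem_image_of_mem _ hA)))
    · have := h _ (Finset.mem_union_right _ (Finset.mem_union_right _
        (Finset.mem_image_of_mem (fun A => - lf A) (Finset.mem_sdiff.2 ⟨hA, hAS⟩))))
      rw [evR_neg_left] at this
      linarith
  · rintro ⟨h1, h2, h3⟩ l hl
    rcases Finset.mem_union.1 hl with hl | hl
    · exact h1 l hl
    rcases Finset.mem_union.1 hl with hl | hl
    · obtain ⟨A, hA, rfl⟩ := Finset.mem_image.1 hl
      exact h2 A hA
    · obtain ⟨A, hA, rfl⟩ := Finset.mem_image.1 hl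
      rw [Finset.mem_sdiff] at hA
      have := h3 A hA.1 hA.2
      rw [evR_neg_left]
      linarith

/-- The sign pattern of a point. -/
noncomputable def sgn (H : Finset (Set (Fin d → ℝ))) (lf : Set (Fin d → ℝ) → CoV d)
    (x : Fin d → ℝ) : Finset (Set (Fin d → ℝ)) := H.filter (fun A => 0 < evR (lf A) x 1)

theorem sgn_eq (I : Finset (CoV d)) (H : Finset (Set (Fin d → ℝ)))
    (lf : Set (Fin d → ℝ) → CoV d) (S : Finset (Set (Fin d → ℝ))) (hS : S ⊆ H) (x : Fin d → ℝ)
    (hx : x ∈ opR (regI I H lf S)) : S = sgn H lf x := by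
  rw [mem_opR_regI] at hx
  ext A
  rw [sgn, Finset.mem_filter]
  refine ⟨fun hA => ⟨hS hA, hx.2.1 A hA⟩, fun hA => ?_⟩
  by_contra hAS
  have := hx.2.2 A hA.1 hAS
  linarith [hA.2]

theorem mem_complement_iff (I : Finset (CoV d)) (H : Finset (Set (Fin d → ℝ)))
    (lf : Set (Fin d → ℝ) → CoV d) (hlf : ∀ A ∈ H, ∀ x, x ∈ A ↔ evR (lf A) x 1 = 0)
    (x : Fin d → ℝ) : x ∈ opR I \ ⋃₀ (H : Set (Set (Fin d → ℝ))) ↔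
      x ∈ opR (regI I H lf (sgn H lf x)) := by
  rw [mem_opR_regI]
  constructor
  · rintro ⟨h1, h2⟩
    refine ⟨h1, fun A hA => (Finset.mem_filter.1 hA).2, fun A hA hAS => ?_⟩
    have h3 : ¬ 0 < evR (lf A) x 1 := fun h => hAS (Finset.mem_filter.2 ⟨hA, h⟩)
    refine lt_of_le_of_ne (not_lt.1 h3) fun h => h2 ⟨A, hA, (hlf A hA x).2 h⟩
  · rintro ⟨h1, h2, h3⟩
    refine ⟨h1, ?_⟩
    rintro ⟨A, hA, hxA⟩
    have h0 := (hlf A hA x).1 hxA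
    by_cases hAS : A ∈ sgn H lf x
    · have := h2 A hAS
      linarith
    · have := h3 A hA hAS
      linarith

theorem component_eq (I : Finset (CoV d)) (H : Finset (Set (Fin d → ℝ)))
    (lf : Set (Fin d → ℝ) → CoV d) (hlf : ∀ A ∈ H, ∀ x, x ∈ A ↔ evR (lf A) x 1 = 0)
    (y : Fin d → ℝ) (hy : y ∈ opR I \ ⋃₀ (H : Set (Set (Fin d → ℝ)))) :
    connectedComponentIn (opR I \ ⋃₀ (H : Set (Set (Fin d → ℝ)))) y =
      opR (regI I H lf (sgn H lf y)) := by
  set F := opR I \ ⋃₀ (H : Set (Set (Fin d → ℝ))) with hF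
  have hsub : opR (regI I H lf (sgn H lf y)) ⊆ F := fun x hx => by
    have := sgn_eq I H lf (sgn H lf y) (Finset.filter_subset _ _) x hx
    rw [this] at hx
    exact (mem_complement_iff I H lf hlf x).2 hx
  apply Set.Subset.antisymm
  · intro x hx
    have hxF : x ∈ F := connectedComponentIn_subset F y hx
    have hsg : sgn H lf x = sgn H lf y := by
      refine Finset.filter_congr fun A hA => ?_
      have hpre : IsPreconnected ((fun z => evR (lf A) z 1) '' connectedComponentIn F y) :=
        isPreconnected_connectedComponentIn.image _ (continuous_evR _).continuousOn
      have hoc := hpre.ordConnected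
      have hmx := Set.mem_image_of_mem (fun z => evR (lf A) z 1) hx
      have hmy := Set.mem_image_of_mem (fun z => evR (lf A) z 1) (mem_connectedComponentIn hy)
      have h0 : (0 : ℝ) ∉ (fun z => evR (lf A) z 1) '' connectedComponentIn F y := by
        rintro ⟨z, hz, hz0⟩
        exact (connectedComponentIn_subset F y hz).2 ⟨A, hA, (hlf A hA z).2 hz0⟩
      constructor
      · intro h
        by_contra h'
        exact h0 (hoc.out hmy hmx ⟨not_lt.1 h', h.le⟩)
      · intro h
        by_contra h'
        exact h0 (hoc.out hmx hmy ⟨not_lt.1 h', h.le⟩)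
    rw [← hsg]
    exact (mem_complement_iff I H lf hlf x).1 hxF
  · exact (convex_opR _).isPreconnected.subset_connectedComponentIn
      ((mem_complement_iff I H lf hlf y).1 hy) hsub

end EhrhartRec

/-- **Inside-out reciprocity (Beck–Zaslavsky).** Let `P ⊂ ℝ^d` be a full-dimensional rational
polytope and `H` a finite set of rational affine hyperplanes. For positive integers `t`, let
`I(t)` count the points of `(1/t)ℤ^d` in `P° ∖ ⋃H` and let `O(t)` be the sum over the points
`x ∈ (1/t)ℤ^d ∩ P` of the number of closed regions of `(P,H)` containing `x` (regions are
the connected components of `P° ∖ ⋃H`). Then `I` and `O` agree with quasipolynomials `f`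
and `g` on positive integers, and `f(-t) = (-1)^d g(t)` for all integers `t ≥ 1`. -/
theorem inside_out_reciprocity (d : ℕ) (P : Set (Fin d → ℝ)) (H : Finset (Set (Fin d → ℝ)))
    (hP : ∃ Vs : Finset (Fin d → ℚ),
      P = convexHull ℝ ((fun v : Fin d → ℚ => fun i => (v i : ℝ)) '' (Vs : Set (Fin d → ℚ))))
    (hfull : affineSpan ℝ P = ⊤)
    (hH : ∀ A ∈ H, ∃ (a : Fin d → ℚ) (b : ℚ), a ≠ 0 ∧
      A = {x : Fin d → ℝ | ∑ i, (a i : ℝ) * x i = (b : ℝ)}) :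
    ∃ f g : ℤ → ℚ, IsQuasiPoly f ∧ IsQuasiPoly g ∧
      (∀ t : ℤ, 1 ≤ t →
        f t = (Nat.card {x : Fin d → ℤ //
          (fun i => (x i : ℝ) / (t : ℝ)) ∈ interior P \ ⋃₀ (H : Set (Set (Fin d → ℝ)))} : ℚ)) ∧
      (∀ t : ℤ, 1 ≤ t →
        g t = ∑ᶠ x : Fin d → ℤ,
          (if (fun i => (x i : ℝ) / (t : ℝ)) ∈ P then
            (Nat.card {R : Set (Fin d → ℝ) //
              (∃ y ∈ interior P \ ⋃₀ (H : Set (Set (Fin d → ℝ))),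
                R = connectedComponentIn (interior P \ ⋃₀ (H : Set (Set (Fin d → ℝ)))) y) ∧
              (fun i => (x i : ℝ) / (t : ℝ)) ∈ closure R} : ℚ)
          else 0)) ∧
      (∀ t : ℤ, 1 ≤ t → f (-t) = (-1) ^ d * g t) := by
  obtain ⟨I, h01, hPI, hint, R, hR⟩ := EhrhartRec.polytope_description P hP
  obtain ⟨lf, hlf⟩ : ∃ lf : Set (Fin d → ℝ) → EhrhartRec.CoV d,
      ∀ A ∈ H, ∀ x, x ∈ A ↔ EhrhartRec.evR (lf A) x 1 = 0 := by
    have : ∀ A : Set (Fin d → ℝ), ∃ l : EhrhartRec.CoV d,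
        A ∈ H → ∀ x, x ∈ A ↔ EhrhartRec.evR l x 1 = 0 := fun A => by
      by_cases hA : A ∈ H
      · obtain ⟨a, b, -, hab⟩ := hH A hA
        refine ⟨(a, -b), fun _ x => ?_⟩
        rw [hab, Set.mem_ofPred_eq, ← sub_eq_zero]
        simp [EhrhartRec.evR, sub_eq_add_neg]
      · exact ⟨0, fun h => absurd h hA⟩
    choose lf hlf using this
    exact ⟨lf, hlf⟩
  rw [hint]
  set F := EhrhartRec.opR I \ ⋃₀ (H : Set (Set (Fin d → ℝ))) with hF
  let rg : Finset (Set (Fin d → ℝ)) → Finset (EhrhartRec.CoV d) := EhrhartRec.regI I H lf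
  let SS := H.powerset.filter (fun S => (EhrhartRec.opR (rg S)).Nonempty)
  have hclsub : ∀ S, EhrhartRec.clR (rg S) ⊆ P := fun S x hx => by
    rw [hPI]
    exact fun l hl => hx l (Finset.mem_union_left _ hl)
  have hbd : ∀ S, ∀ x ∈ EhrhartRec.clR (rg S), ∀ i, |x i| ≤ R := fun S x hx => hR x (hclsub S hx)
  have hE : ∀ S, ∃ g : ℤ → ℚ, S ∈ SS → IsQuasiPoly g ∧
      (∀ t : ℤ, 1 ≤ t → g t = ∑ᶠ x : Fin d → ℤ,
        if (fun i => (x i : ℝ) / (t : ℝ)) ∈ EhrhartRec.clR (rg S) then (1 : ℚ) else 0) ∧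
      (∀ t : ℤ, 1 ≤ t → g (-t) = (-1) ^ d * ∑ᶠ x : Fin d → ℤ,
        if (fun i => (x i : ℝ) / (t : ℝ)) ∈ EhrhartRec.opR (rg S) then (1 : ℚ) else 0) := fun S => by
    by_cases hS : S ∈ SS
    · obtain ⟨g, hg⟩ := EhrhartRec.ehrhart (rg S) (Finset.mem_union_left _ h01)
        (Finset.mem_filter.1 hS).2 R (hbd S)
      exact ⟨g, fun _ => hg⟩
    · exact ⟨0, fun h => absurd h hS⟩
  choose G hG using hE
  have hsq : ((-1 : ℚ) ^ d) * (-1) ^ d = 1 := by rw [← mul_pow]; simp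
  have hgq : IsQuasiPoly (fun t => ∑ S ∈ SS, G S t) := EhrhartRec.qp_sum SS G fun S hS => (hG S hS).1
  refine ⟨fun t => (-1) ^ d * (fun t => ∑ S ∈ SS, G S t) (-t), fun t => ∑ S ∈ SS, G S t,
    EhrhartRec.qp_reflect _ hgq, hgq, fun t ht => ?_, fun t ht => ?_, fun t ht => ?_⟩
  · -- the interior count
    have hfinF : {x : Fin d → ℤ | (fun i => (x i : ℝ) / (t : ℝ)) ∈ F}.Finite :=
      EhrhartRec.finite_lattice F R (fun x hx => hR x (interior_subset (hint ▸ hx.1))) t ht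
    have e1 := EhrhartRec.finsum_ind _ hfinF
    refine Eq.trans ?_ e1
    simp only
    rw [Finset.sum_congr rfl fun S hS => (hG S hS).2.2 t ht, ← Finset.mul_sum, ← mul_assoc, hsq,
      one_mul, ← finsum_sum_comm]
    · refine finsum_congr fun x => ?_
      set p : Fin d → ℝ := fun i => (x i : ℝ) / (t : ℝ) with hp
      rw [Set.mem_ofPred_eq]
      by_cases hpF : p ∈ F
      · rw [if_pos hpF]
        have hpS := (EhrhartRec.mem_complement_iff I H lf hlf p).1 hpF
        have hmem : EhrhartRec.sgn H lf p ∈ SS :=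
          Finset.mem_filter.2 ⟨Finset.mem_powerset.2 (Finset.filter_subset _ _), ⟨p, hpS⟩⟩
        rw [Finset.sum_eq_single_of_mem _ hmem]
        · exact if_pos hpS
        · intro S hS hne
          rw [if_neg]
          intro hpS'
          exact hne (EhrhartRec.sgn_eq I H lf S
            (Finset.mem_powerset.1 (Finset.mem_filter.1 hS).1) p hpS')
      · rw [if_neg hpF]
        refine Finset.sum_eq_zero fun S hS => if_neg fun hpS => hpF ?_
        rw [EhrhartRec.sgn_eq I H lf S (Finset.mem_powerset.1 (Finset.mem_filter.1 hS).1) p hpS] at hpS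
        exact (EhrhartRec.mem_complement_iff I H lf hlf p).2 hpS
    · intro S _
      refine (EhrhartRec.finite_lattice (EhrhartRec.clR (rg S)) R (hbd S) t ht).subset fun x hx => ?_
      by_contra hcon
      exact hx (if_neg fun h => hcon (EhrhartRec.opR_subset_clR _ h))
  · -- the closed count with multiplicities
    beta_reduce
    rw [Finset.sum_congr rfl fun S hS => (hG S hS).2.1 t ht, ← finsum_sum_comm]
    · refine finsum_congr fun x => ?_
      set p : Fin d → ℝ := fun i => (x i : ℝ) / (t : ℝ) with hp
      by_cases hpP : p ∈ P
      · rw [if_pos hpP]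
        have hset : {Rg : Set (Fin d → ℝ) | (∃ y ∈ F, Rg = connectedComponentIn F y) ∧
            p ∈ closure Rg} =
            (((SS.filter (fun S => p ∈ EhrhartRec.clR (rg S))).image (fun S => EhrhartRec.opR (rg S)) :
              Finset (Set (Fin d → ℝ))) : Set (Set (Fin d → ℝ))) := by
          ext Rg
          simp only [Set.mem_ofPred_eq, Finset.coe_image, Set.mem_image, Finset.mem_coe,
            Finset.mem_filter]
          constructor
          · rintro ⟨⟨y, hy, rfl⟩, hcl⟩
            rw [EhrhartRec.component_eq I H lf hlf y hy] at hcl ⊢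
            have hyS := (EhrhartRec.mem_complement_iff I H lf hlf y).1 hy
            rw [EhrhartRec.closure_opR _ ⟨y, hyS⟩] at hcl
            exact ⟨EhrhartRec.sgn H lf y, ⟨Finset.mem_filter.2
              ⟨Finset.mem_powerset.2 (Finset.filter_subset _ _), ⟨y, hyS⟩⟩, hcl⟩, rfl⟩
          · rintro ⟨S, ⟨hS, hpS⟩, rfl⟩
            obtain ⟨hSH, y, hy⟩ := Finset.mem_filter.1 hS
            have hSy := EhrhartRec.sgn_eq I H lf S (Finset.mem_powerset.1 hSH) y hy
            refine ⟨⟨y, ?_, ?_⟩, ?_⟩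
            · exact (EhrhartRec.mem_complement_iff I H lf hlf y).2 (hSy ▸ hy)
            · rw [EhrhartRec.component_eq I H lf hlf y
                ((EhrhartRec.mem_complement_iff I H lf hlf y).2 (hSy ▸ hy)), ← hSy]
            · rw [EhrhartRec.closure_opR _ ⟨y, hy⟩]
              exact hpS
        have hcard : Nat.card {Rg : Set (Fin d → ℝ) // (∃ y ∈ F, Rg = connectedComponentIn F y) ∧
            p ∈ closure Rg} = (SS.filter (fun S => p ∈ EhrhartRec.clR (rg S))).card := by
          have h1 : Nat.card {Rg : Set (Fin d → ℝ) // (∃ y ∈ F, Rg = connectedComponentIn F y) ∧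
            p ∈ closure Rg} = Set.ncard {Rg : Set (Fin d → ℝ) |
              (∃ y ∈ F, Rg = connectedComponentIn F y) ∧ p ∈ closure Rg} := rfl
          rw [h1, hset, Set.ncard_coe_finset, Finset.card_image_of_injOn]
          intro S hS T hT hST
          obtain ⟨hSH, y, hy⟩ := Finset.mem_filter.1 (Finset.mem_filter.1 hS).1
          obtain ⟨hTH, -⟩ := Finset.mem_filter.1 (Finset.mem_filter.1 hT).1
          rw [EhrhartRec.sgn_eq I H lf S (Finset.mem_powerset.1 hSH) y hy]
          have hy' : y ∈ EhrhartRec.opR (rg T) := by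
            have h2 : EhrhartRec.opR (rg S) = EhrhartRec.opR (rg T) := hST
            rw [← h2]; exact hy
          rw [EhrhartRec.sgn_eq I H lf T (Finset.mem_powerset.1 hTH) y hy']
        rw [hcard, Finset.sum_boole]
      · rw [if_neg hpP]
        exact Finset.sum_eq_zero fun S _ => if_neg fun h => hpP (hclsub S h)
    · intro S _
      refine (EhrhartRec.finite_lattice (EhrhartRec.clR (rg S)) R (hbd S) t ht).subset fun x hx => ?_
      by_contra hcon
      exact hx (if_neg hcon)
  · simp only [neg_neg]
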